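/- Let I = [0,T] be a bounded time interval and B a separable, reflexive, uniformly smooth Banach space which is I-smoothly weakly compact for an exponent p ∈ [2,∞). Let f : B → B be a bounded continuous function, r > 0, and C ⊂ B a nonempty, ball-compact, (r,f)-prox-regular set. Then for every u₀ ∈ C, the sweeping process u̇(t) + N(C,u(t)) ∋ f(u(t)), u(0) = u₀, has an absolutely continuous solution u with u(t) ∈ C for all t ∈ I, which moreover satisfies ‖u̇(t) − f(u(t))‖ ≤ ‖f‖_∞ for almost every t ∈ I. -/

import Mathlib

open MeasureTheory Set Filter Topology

noncomputable section

/-- The (set-valued) metric projection onto `C`: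
`P_C(y) = {z ∈ C | ‖y - z‖ = d(y,C)}`. -/
def projSet {E : Type*} [NormedAddCommGroup E] (C : Set E) (y : E) : Set E :=
  {z | z ∈ C ∧ ‖y - z‖ = Metric.infDist y C}

/-- The proximal normal cone of `C` at `x`:
`N(C,x) = {v | ∃ s > 0, x ∈ P_C(x + s v)}`. -/
def proxNormalCone {E : Type*} [NormedAddCommGroup E] [NormedSpace ℝ E]
    (C : Set E) (x : E) : Set E :=
  {v | ∃ s : ℝ, 0 < s ∧ x ∈ projSet C (x + s • v)}

/-- `Γ^r(C,x) = {v | x ∈ P_C(x + r v)}`, the good directions to project at scale `r`. -/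
def gammaSet {E : Type*} [NormedAddCommGroup E] [NormedSpace ℝ E]
    (r : ℝ) (C : Set E) (x : E) : Set E :=
  {v | x ∈ projSet C (x + r • v)}

/-- `C` is `(r,f)`-prox-regular (`r`-prox-regular in the direction `f`): for all `x ∈ C`
and `s ∈ (0,r)`, the projection `z` of `x + s f(x)/‖f(x)‖` onto `C` is well defined
(single valued), and the normalized vector from `z` to `x + s f(x)/‖f(x)‖` belongs to
`Γ^r(C,z)` (with the convention `v/‖v‖ = 0` when `v = 0`). -/
def DirProxRegular {E : Type*} [NormedAddCommGroup E] [NormedSpace ℝ E]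
    (r : ℝ) (f : E → E) (C : Set E) : Prop :=
  ∀ x ∈ C, ∀ s : ℝ, 0 < s → s < r →
    ∃ z : E, projSet C (x + (s * ‖f x‖⁻¹) • f x) = {z} ∧
      ‖x + (s * ‖f x‖⁻¹) • f x - z‖⁻¹ • (x + (s * ‖f x‖⁻¹) • f x - z) ∈ gammaSet r C z

/-- A subset is ball-compact if its intersection with every closed ball is compact. -/
def BallCompact {E : Type*} [NormedAddCommGroup E] (C : Set E) : Prop :=
  ∀ (x : E) (R : ℝ), IsCompact (C ∩ Metric.closedBall x R)

/-- A uniformly smooth normed space: the norm is uniformly Fréchet differentiable away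
from `0`, expressed through the vanishing of the modulus of smoothness. -/
def UniformlySmooth (E : Type*) [NormedAddCommGroup E] [NormedSpace ℝ E] : Prop :=
  ∀ ε > (0:ℝ), ∃ δ > (0:ℝ), ∀ x y : E, ‖x‖ = 1 → ‖y‖ ≤ δ →
    ‖x + y‖ + ‖x - y‖ - 2 ≤ ε * ‖y‖

/-- A reflexive normed space: the canonical embedding into the double dual is onto. -/
def ReflexiveSpace (E : Type*) [NormedAddCommGroup E] [NormedSpace ℝ E] : Prop :=
  Function.Surjective (NormedSpace.inclusionInDoubleDual ℝ E)

/-- The normalized duality-type mapping `J_p(x) = (1/p) (∇‖·‖^p)(x) ∈ E*`. -/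
def dualMapJ {E : Type*} [NormedAddCommGroup E] [NormedSpace ℝ E]
    (p : ℝ) (x : E) : E →L[ℝ] ℝ :=
  p⁻¹ • fderiv ℝ (fun z : E => ‖z‖ ^ p) x

/-- `E` is `I`-smoothly weakly compact for the exponent `p`: from every bounded sequence of
`L^∞(I,E)` one can extract a subsequence weakly-* converging (through the duality
`L^∞(I,E) = (L¹(I,E*))*`) to some `y ∈ L^∞(I,E)` along which the integral quantities
built from `J_p` pass to the limit. -/
def ISmoothlyWeaklyCompact (I : Set ℝ)
    (E : Type*) [NormedAddCommGroup E] [NormedSpace ℝ E] (p : ℝ) : Prop :=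
  ∀ x : ℕ → ℝ → E,
    (∀ n, AEStronglyMeasurable (x n) (volume.restrict I)) →
    (∃ M : ℝ, ∀ n, ∀ᵐ t ∂volume.restrict I, ‖x n t‖ ≤ M) →
    ∃ k : ℕ → ℕ, StrictMono k ∧ ∃ y : ℝ → E,
      AEStronglyMeasurable y (volume.restrict I) ∧
      (∃ M : ℝ, ∀ᵐ t ∂volume.restrict I, ‖y t‖ ≤ M) ∧
      (∀ g : ℝ → (E →L[ℝ] ℝ), Integrable g (volume.restrict I) →
        Tendsto (fun n => ∫ t, g t (x (k n) t) ∂volume.restrict I) atTop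
          (𝓝 (∫ t, g t (y t) ∂volume.restrict I))) ∧
      (∀ z : ℝ → E, AEStronglyMeasurable z (volume.restrict I) →
        (∃ M : ℝ, ∀ᵐ t ∂volume.restrict I, ‖z t‖ ≤ M) →
        ∀ φ : ℝ → ℝ, Integrable φ (volume.restrict I) →
          Tendsto (fun n => ∫ t,
              (dualMapJ p (z t + x (k n) t) - dualMapJ p (x (k n) t)) (x (k n) t) * φ t
                ∂volume.restrict I) atTop
            (𝓝 (∫ t, (dualMapJ p (z t + y t) - dualMapJ p (y t)) (y t) * φ t
                ∂volume.restrict I)))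

/-- An absolutely continuous solution of the sweeping process
`u̇(t) + N(C(t),u(t)) ∋ f(u(t))`, `u(0) = u₀`, on `[0,T]`: `u` is absolutely continuous,
i.e. `u(t) = u₀ + ∫₀ᵗ g` for some Bochner-integrable density `g` (`g = u̇` a.e.),
`u(t) ∈ C(t)` for all `t ∈ [0,T]` and `f(u(t)) - u̇(t) ∈ N(C(t),u(t))` a.e. on `[0,T]`. -/
def IsSweepingSol {E : Type*} [NormedAddCommGroup E] [NormedSpace ℝ E] [CompleteSpace E]
    (C : ℝ → Set E) (f : E → E) (T : ℝ) (u₀ : E) (u : ℝ → E) : Prop :=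
  ∃ g : ℝ → E, IntegrableOn g (Set.Icc 0 T) ∧
    (∀ t ∈ Set.Icc (0:ℝ) T, u t = u₀ + ∫ s in (0:ℝ)..t, g s) ∧
    (∀ t ∈ Set.Icc (0:ℝ) T, u t ∈ C t) ∧
    (∀ᵐ t ∂volume.restrict (Set.Icc (0:ℝ) T),
      f (u t) - g t ∈ proxNormalCone (C t) (u t))

/-- In a uniformly smooth space the norm is Fréchet differentiable away from the origin. -/
theorem UniformlySmooth.differentiableAt_norm {E : Type*} [NormedAddCommGroup E]
    [NormedSpace ℝ E] (h : UniformlySmooth E) {x : E} (hx : x ≠ 0) :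
    DifferentiableAt ℝ (fun z : E => ‖z‖) x := by
  obtain ⟨l, hl1, hlx⟩ := exists_dual_vector'' ℝ x
  have hlx' : l x = ‖x‖ := by simpa using hlx
  have hx0 : 0 < ‖x‖ := norm_pos_iff.2 hx
  have hle : ∀ v, l v ≤ ‖v‖ := fun v =>
    (le_abs_self _).trans <| (l.le_opNorm v).trans (by nlinarith [norm_nonneg v])
  refine HasFDerivAt.differentiableAt (f' := l) ?_
  rw [hasFDerivAt_iff_isLittleO_nhds_zero, Asymptotics.isLittleO_iff]
  intro ε hε
  obtain ⟨δ, hδ, H⟩ := h ε hε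
  filter_upwards [Metric.ball_mem_nhds (0 : E) (mul_pos hδ hx0)] with y hy
  rw [mem_ball_zero_iff] at hy
  have key := H (‖x‖⁻¹ • x) (‖x‖⁻¹ • y)
    (by rw [norm_smul, norm_inv, norm_norm, inv_mul_cancel₀ hx0.ne'])
    (by rw [norm_smul, norm_inv, norm_norm, inv_mul_le_iff₀ hx0]; linarith)
  rw [← smul_add, ← smul_sub, norm_smul, norm_smul, norm_smul, norm_inv, norm_norm] at key
  have key2 : ‖x + y‖ + ‖x - y‖ - 2 * ‖x‖ ≤ ε * ‖y‖ := by
    have := mul_le_mul_of_nonneg_left key hx0.le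
    field_simp at this
    linarith
  have h1 := hle (x + y)
  have h2 := hle (x - y)
  rw [map_add, hlx'] at h1
  rw [map_sub, hlx'] at h2
  rw [Real.norm_of_nonneg (by linarith)]
  linarith

/-- In a uniformly smooth space the powers `‖·‖ ^ p`, `1 < p`, are Fréchet differentiable. -/
theorem UniformlySmooth.differentiable_norm_rpow {E : Type*} [NormedAddCommGroup E]
    [NormedSpace ℝ E] (h : UniformlySmooth E) {p : ℝ} (hp : 1 < p) :
    Differentiable ℝ (fun z : E => ‖z‖ ^ p) := by
  intro x
  by_cases hx : x = 0
  · subst hx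
    refine HasFDerivAt.differentiableAt (f' := 0) ?_
    rw [hasFDerivAt_iff_isLittleO_nhds_zero]
    have e : (fun y : E => ‖(0 : E) + y‖ ^ p - ‖(0 : E)‖ ^ p - (0 : E →L[ℝ] ℝ) y)
        = fun y : E => ‖y‖ * ‖y‖ ^ (p - 1) := by
      ext y
      rw [← Real.rpow_one_add' (norm_nonneg y) (by linarith)]
      simp [(zero_lt_one.trans hp).ne']
    rw [e]
    have h0 : Tendsto (fun y : E => ‖y‖ ^ (p - 1)) (𝓝 0) (𝓝 0) := by
      have := ((continuous_norm (E := E)).rpow_const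
        (fun _ => Or.inr (by linarith : 0 ≤ p - 1))).tendsto (0 : E)
      simpa [Real.zero_rpow (by linarith : p - 1 ≠ 0)] using this
    have : (fun y : E => ‖y‖ * ‖y‖ ^ (p - 1)) =o[𝓝 0] fun y : E => ‖y‖ * (1 : ℝ) :=
      (Asymptotics.isBigO_refl _ _).mul_isLittleO
        ((Asymptotics.isLittleO_one_iff ℝ).2 h0)
    simp only [mul_one] at this
    exact this.of_norm_right
  · exact (h.differentiableAt_norm hx).rpow_const (Or.inl (norm_ne_zero_iff.2 hx))

theorem abs_rpow_sub_rpow_le {p R a b : ℝ} (hp : 1 ≤ p) (ha : 0 ≤ a) (hb : 0 ≤ b)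
    (haR : a ≤ R) (hbR : b ≤ R) : |a ^ p - b ^ p| ≤ p * R ^ (p - 1) * |a - b| := by
  have := Convex.norm_image_sub_le_of_norm_deriv_le (𝕜 := ℝ) (f := fun x : ℝ => x ^ p)
    (s := Icc 0 R) (x := b) (y := a) (C := p * R ^ (p - 1))
    (fun x _ => (Real.hasDerivAt_rpow_const (Or.inr hp)).differentiableAt) (fun x hx => by
      rw [(Real.hasDerivAt_rpow_const (Or.inr hp)).deriv, Real.norm_of_nonneg
        (mul_nonneg (by linarith) (Real.rpow_nonneg hx.1 _))]
      exact mul_le_mul_of_nonneg_left (Real.rpow_le_rpow hx.1 hx.2 (by linarith))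
        (by linarith)) (convex_Icc 0 R) ⟨hb, hbR⟩ ⟨ha, haR⟩
  simpa [Real.norm_eq_abs] using this

theorem abs_norm_rpow_sub_norm_rpow_le {E : Type*} [SeminormedAddCommGroup E] {p R : ℝ}
    (hp : 1 ≤ p) {a b : E} (ha : ‖a‖ ≤ R) (hb : ‖b‖ ≤ R) :
    |‖a‖ ^ p - ‖b‖ ^ p| ≤ p * R ^ (p - 1) * ‖a - b‖ :=
  (abs_rpow_sub_rpow_le hp (norm_nonneg a) (norm_nonneg b) ha hb).trans <|
    mul_le_mul_of_nonneg_left (abs_norm_sub_norm_le a b)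
      (mul_nonneg (by linarith) (Real.rpow_nonneg ((norm_nonneg a).trans ha) _))

theorem norm_dualMapJ_le {E : Type*} [NormedAddCommGroup E] [NormedSpace ℝ E] {p R : ℝ}
    (hp : 1 ≤ p) {a : E} (ha : ‖a‖ < R) : ‖dualMapJ p a‖ ≤ R ^ (p - 1) := by
  have hR : 0 ≤ R ^ (p - 1) := Real.rpow_nonneg ((norm_nonneg a).trans ha.le) _
  have h : ‖fderiv ℝ (fun z : E => ‖z‖ ^ p) a‖ ≤ p * R ^ (p - 1) := by
    refine norm_fderiv_le_of_lip' ℝ (mul_nonneg (by linarith) hR) ?_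
    filter_upwards [(isOpen_lt continuous_norm continuous_const).mem_nhds ha] with x hx
    exact abs_norm_rpow_sub_norm_rpow_le hp (le_of_lt hx) ha.le
  rw [dualMapJ, norm_smul, norm_inv, Real.norm_of_nonneg (by linarith),
    inv_mul_le_iff₀ (by linarith)]
  exact h

theorem UniformlySmooth.hasFDerivAt_norm_rpow {E : Type*} [NormedAddCommGroup E]
    [NormedSpace ℝ E] (h : UniformlySmooth E) {p : ℝ} (hp : 1 < p) (a : E) :
    HasFDerivAt (fun z : E => ‖z‖ ^ p) (p • dualMapJ p a) a := by
  rw [dualMapJ, smul_smul, mul_inv_cancel₀ (by linarith), one_smul]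
  exact (h.differentiable_norm_rpow hp a).hasFDerivAt

/-- Euler's identity for the homogeneous function `‖·‖ ^ p`. -/
theorem UniformlySmooth.dualMapJ_apply_self {E : Type*} [NormedAddCommGroup E]
    [NormedSpace ℝ E] (h : UniformlySmooth E) {p : ℝ} (hp : 1 < p) (a : E) :
    dualMapJ p a a = ‖a‖ ^ p := by
  have h1 : HasDerivAt (fun s : ℝ => ‖s • a‖ ^ p) ((p • dualMapJ p a) a) 1 := by
    refine HasFDerivAt.comp_hasDerivAt (f := fun s : ℝ => s • a) (1 : ℝ)
      (l := fun z : E => ‖z‖ ^ p) ?_ ?_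
    · rw [one_smul]
      exact h.hasFDerivAt_norm_rpow hp a
    · simpa using (hasDerivAt_id (1 : ℝ)).smul_const a
  have h2 : HasDerivAt (fun s : ℝ => ‖s • a‖ ^ p) (p * ‖a‖ ^ p) 1 := by
    have := (Real.hasDerivAt_rpow_const (x := 1) (p := p) (Or.inr hp.le)).mul_const (‖a‖ ^ p)
    rw [Real.one_rpow, mul_one] at this
    refine this.congr_of_eventuallyEq ?_
    filter_upwards [lt_mem_nhds (zero_lt_one (α := ℝ))] with s hs
    rw [norm_smul, Real.mul_rpow (norm_nonneg _) (norm_nonneg _), Real.norm_of_nonneg hs.le]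
  have h3 := h1.unique h2
  rw [smul_apply, smul_eq_mul] at h3
  exact mul_left_cancel₀ (by linarith) h3

/-- The derivative of `σ ↦ ‖σ z + y‖ ^ p`, written with the pairing against `y`. -/
theorem UniformlySmooth.hasDerivAt_norm_smul_add_rpow {E : Type*} [NormedAddCommGroup E]
    [NormedSpace ℝ E] (h : UniformlySmooth E) {p : ℝ} (hp : 1 < p) (y z : E) {σ : ℝ}
    (hσ : σ ≠ 0) :
    HasDerivAt (fun s : ℝ => ‖s • z + y‖ ^ p - ‖y‖ ^ p)
      (p / σ * ((‖σ • z + y‖ ^ p - ‖y‖ ^ p)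
        - (dualMapJ p (σ • z + y) - dualMapJ p y) y)) σ := by
  have h1 : HasDerivAt (fun s : ℝ => ‖s • z + y‖ ^ p)
      ((p • dualMapJ p (σ • z + y)) z) σ := by
    refine HasFDerivAt.comp_hasDerivAt (f := fun s : ℝ => s • z + y) σ
      (l := fun z : E => ‖z‖ ^ p) (h.hasFDerivAt_norm_rpow hp _) ?_
    simpa using ((hasDerivAt_id σ).smul_const z).add_const y
  have e := h.dualMapJ_apply_self hp (σ • z + y)
  rw [map_add, map_smul, smul_eq_mul] at e
  refine (h1.sub_const (‖y‖ ^ p)).congr_deriv ?_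
  rw [sub_apply, h.dualMapJ_apply_self hp y, ← e, smul_apply, smul_eq_mul]
  field_simp
  ring

/-- Solutions of `D' = (p / σ) (D - E)` with vanishing right-hand side `E` and growth smaller
than `σ ^ p` vanish in the limit. -/
theorem tendsto_zero_of_hasDerivAt_div_mul_sub {p c : ℝ} (hp : 0 < p) {D E : ℕ → ℝ → ℝ}
    {b : ℝ → ℝ}
    (hD : ∀ n σ, 0 < σ → HasDerivAt (D n) (p / σ * (D n σ - E n σ)) σ)
    (hE : ∀ σ, 0 < σ → Tendsto (fun n => E n σ) atTop (𝓝 0))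
    (hEb : ∀ n S σ, 1 ≤ σ → σ ≤ S → |E n σ| ≤ b S)
    (hDb : ∀ n σ, 1 ≤ σ → |D n σ| ≤ c * σ ^ (p - 1)) :
    Tendsto (fun n => D n 1) atTop (𝓝 0) := by
  set K : ℕ → ℝ → ℝ := fun n σ => σ ^ (-p) * D n σ with hK
  have hKd : ∀ n σ, 0 < σ → HasDerivAt (K n) (-p * σ ^ (-p - 1) * E n σ) σ := by
    intro n σ hσ
    have h1 := (Real.hasDerivAt_rpow_const (x := σ) (p := -p) (Or.inl hσ.ne')).mul (hD n σ hσ)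
    refine h1.congr_deriv ?_
    rw [Real.rpow_sub_one hσ.ne']
    field_simp
    ring
  have hderiv : ∀ n σ, 0 < σ → deriv (K n) σ = -p * σ ^ (-p - 1) * E n σ :=
    fun n σ hσ => (hKd n σ hσ).deriv
  have hc : 0 ≤ c := by
    have := (abs_nonneg _).trans (hDb 0 1 le_rfl)
    simpa using this
  have hbd : ∀ n S σ, 1 ≤ σ → σ ≤ S → ‖deriv (K n) σ‖ ≤ p * b S := by
    intro n S σ h1 hS
    have h0 : 0 < σ := by linarith
    rw [hderiv n σ h0, norm_mul, norm_mul, norm_neg, Real.norm_of_nonneg hp.le,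
      Real.norm_of_nonneg (Real.rpow_nonneg h0.le _), mul_assoc]
    refine mul_le_mul_of_nonneg_left ?_ hp.le
    have h2 : σ ^ (-p - 1) ≤ 1 := Real.rpow_le_one_of_one_le_of_nonpos h1 (by linarith)
    have h3 := hEb n S σ h1 hS
    calc σ ^ (-p - 1) * ‖E n σ‖ ≤ 1 * ‖E n σ‖ :=
          mul_le_mul_of_nonneg_right h2 (norm_nonneg _)
      _ ≤ b S := by rw [one_mul]; exact h3
  have hlim : ∀ S, 1 ≤ S → Tendsto (fun n => K n S - K n 1) atTop (𝓝 0) := by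
    intro S hS
    have hmem : ∀ σ, σ ∈ Set.uIoc 1 S → 1 ≤ σ ∧ σ ≤ S := by
      intro σ hσ
      rw [uIoc_of_le hS] at hσ
      exact ⟨hσ.1.le, hσ.2⟩
    have hint : ∀ n, ∫ σ in (1 : ℝ)..S, deriv (K n) σ = K n S - K n 1 := by
      intro n
      refine intervalIntegral.integral_eq_sub_of_hasDerivAt (fun σ hσ => ?_) ?_
      · rw [uIcc_of_le hS] at hσ
        have h0 : 0 < σ := by linarith [hσ.1]
        rw [hderiv n σ h0]
        exact hKd n σ h0
      · refine (intervalIntegrable_const (c := p * b S)).mono_fun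
          (stronglyMeasurable_deriv _).aestronglyMeasurable ?_
        refine (ae_restrict_iff' measurableSet_uIoc).2 (ae_of_all _ fun σ hσ => ?_)
        exact (hbd n S σ (hmem σ hσ).1 (hmem σ hσ).2).trans (Real.le_norm_self _)
    have h0 : ∫ _ in (1 : ℝ)..S, (0 : ℝ) = 0 := by simp
    rw [← h0]
    simp_rw [← hint]
    refine intervalIntegral.tendsto_integral_filter_of_dominated_convergence
      (fun _ => p * b S) (Eventually.of_forall fun n =>
        (stronglyMeasurable_deriv _).aestronglyMeasurable)
      (Eventually.of_forall fun n => ae_of_all _ fun σ hσ =>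
        hbd n S σ (hmem σ hσ).1 (hmem σ hσ).2) intervalIntegrable_const
      (ae_of_all _ fun σ hσ => ?_)
    have hσ0 : 0 < σ := by linarith [(hmem σ hσ).1]
    simp_rw [hderiv _ σ hσ0]
    simpa using (hE σ hσ0).const_mul (-p * σ ^ (-p - 1))
  have hKS : ∀ n S, 1 ≤ S → |K n S| ≤ c / S := by
    intro n S hS
    have h0 : 0 < S := by linarith
    have := hDb n S hS
    simp only [hK]
    rw [abs_mul, abs_of_nonneg (Real.rpow_nonneg h0.le _)]
    calc S ^ (-p) * |D n S| ≤ S ^ (-p) * (c * S ^ (p - 1)) :=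
          mul_le_mul_of_nonneg_left this (Real.rpow_nonneg h0.le _)
      _ = c / S := by
          rw [Real.rpow_sub_one h0.ne', Real.rpow_neg h0.le]
          have : S ^ p ≠ 0 := (Real.rpow_pos_of_pos h0 _).ne'
          field_simp
  rw [Metric.tendsto_atTop]
  intro ε hε
  set S : ℝ := max 1 (2 * c / ε + 1) with hSdef
  have hS1 : 1 ≤ S := le_max_left _ _
  have hcS : c / S < ε / 2 := by
    have h0 : 0 < S := by linarith
    rw [div_lt_iff₀ h0]
    have : 2 * c / ε + 1 ≤ S := le_max_right _ _
    have h2 : 2 * c / ε < S := by linarith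
    rw [div_lt_iff₀ hε] at h2
    linarith
  obtain ⟨N, hN⟩ := Metric.tendsto_atTop.1 (hlim S hS1) (ε / 2) (by linarith)
  refine ⟨N, fun n hn => ?_⟩
  have h1 := hN n hn
  have h2 := hKS n S hS1
  have h3 : K n 1 = D n 1 := by simp [hK]
  rw [Real.dist_eq, sub_zero] at h1 ⊢
  rw [← h3]
  rw [abs_lt] at h1 ⊢
  rw [abs_le] at h2
  constructor <;> linarith [h1.1, h1.2, h2.1, h2.2]

theorem UniformlySmooth.hasDerivAt_integral_norm_smul_add_rpow {E Ω : Type*}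
    [NormedAddCommGroup E] [NormedSpace ℝ E] (h : UniformlySmooth E) {p : ℝ} (hp : 1 < p)
    [MeasurableSpace Ω] {μ : Measure Ω} [IsFiniteMeasure μ] {y z : Ω → E} {M Z : ℝ}
    (hM : 0 ≤ M) (hZ : 0 ≤ Z) (hy : AEStronglyMeasurable y μ) (hz : AEStronglyMeasurable z μ)
    (hyM : ∀ᵐ t ∂μ, ‖y t‖ ≤ M) (hzZ : ∀ᵐ t ∂μ, ‖z t‖ ≤ Z) {σ : ℝ} (hσ : σ ≠ 0) :
    HasDerivAt (fun s : ℝ => ∫ t, (‖s • z t + y t‖ ^ p - ‖y t‖ ^ p) ∂μ)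
      (p / σ * ((∫ t, (‖σ • z t + y t‖ ^ p - ‖y t‖ ^ p) ∂μ)
        - ∫ t, (dualMapJ p (σ • z t + y t) - dualMapJ p (y t)) (y t) ∂μ)) σ := by
  have hmeas : ∀ s : ℝ,
      AEStronglyMeasurable (fun t => ‖s • z t + y t‖ ^ p - ‖y t‖ ^ p) μ := by
    intro s
    have hc : Continuous fun x : ℝ => x ^ p :=
      Real.continuous_rpow_const (by linarith)
    exact (hc.comp_aestronglyMeasurable ((hz.const_smul s).add hy).norm).sub
      (hc.comp_aestronglyMeasurable hy.norm)
  have hR : ∀ (s : ℝ) (x w : E), |s - σ| < 1 → ‖x‖ ≤ M → ‖w‖ ≤ Z →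
      ‖s • w + x‖ ≤ (|σ| + 1) * Z + M := by
    intro s x w hs hx hw
    have h1 : |s| ≤ |σ| + 1 := by
      have := abs_sub_abs_le_abs_sub s σ
      linarith
    calc ‖s • w + x‖ ≤ |s| * ‖w‖ + ‖x‖ := by
          simpa [norm_smul] using norm_add_le (s • w) x
      _ ≤ (|σ| + 1) * Z + M := by gcongr
  set R : ℝ := (|σ| + 1) * Z + M with hRdef
  have hR0 : 0 ≤ R := by positivity
  have hMR : M ≤ R := by rw [hRdef]; nlinarith [abs_nonneg σ]
  have hint : Integrable (fun t => ‖σ • z t + y t‖ ^ p - ‖y t‖ ^ p) μ := by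
    refine Integrable.mono' (integrable_const (p * R ^ (p - 1) * (|σ| * Z))) (hmeas σ) ?_
    filter_upwards [hyM, hzZ] with t h1 h2
    refine (abs_norm_rpow_sub_norm_rpow_le hp.le (hR σ _ _ (by simp) h1 h2)
      (h1.trans hMR)).trans ?_
    rw [add_sub_cancel_right, norm_smul, Real.norm_eq_abs]
    gcongr
  set F' : Ω → ℝ := fun t => p / σ * ((‖σ • z t + y t‖ ^ p - ‖y t‖ ^ p)
        - (dualMapJ p (σ • z t + y t) - dualMapJ p (y t)) (y t)) with hF'
  have hF'd : ∀ t, HasDerivAt (fun s : ℝ => ‖s • z t + y t‖ ^ p - ‖y t‖ ^ p) (F' t) σ :=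
    fun t => h.hasDerivAt_norm_smul_add_rpow hp (y t) (z t) hσ
  have hF'm : AEStronglyMeasurable F' μ := by
    refine aestronglyMeasurable_of_tendsto_ae (𝓝[≠] σ)
      (f := fun s t => slope (fun s : ℝ => ‖s • z t + y t‖ ^ p - ‖y t‖ ^ p) σ s)
      (fun s => ?_) (ae_of_all _ fun t => (hF'd t).tendsto_slope)
    simp only [slope_def_module]
    exact ((hmeas s).sub (hmeas σ)).const_smul (s - σ)⁻¹
  have key := hasDerivAt_integral_of_dominated_loc_of_lip (μ := μ) (𝕜 := ℝ) (x₀ := σ)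
    (F := fun s t => ‖s • z t + y t‖ ^ p - ‖y t‖ ^ p) (F' := F')
    (bound := fun _ => p * R ^ (p - 1) * Z) (Metric.ball_mem_nhds σ one_pos)
    (Eventually.of_forall hmeas) hint hF'm ?_ (integrable_const _) (ae_of_all _ hF'd)
  · refine key.2.congr_deriv ?_
    have hHint : Integrable
        (fun t => (dualMapJ p (σ • z t + y t) - dualMapJ p (y t)) (y t)) μ := by
      refine (hint.sub (key.1.const_mul (σ / p))).congr (ae_of_all _ fun t => ?_)
      simp only [hF', Pi.sub_apply]
      field_simp
      ring
    rw [hF', integral_const_mul, integral_sub hint hHint]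
  · filter_upwards [hyM, hzZ] with t h1 h2
    refine LipschitzOnWith.of_dist_le_mul fun s hs s' hs' => ?_
    rw [Real.coe_nnabs, abs_of_nonneg (by positivity), Real.dist_eq, Real.dist_eq,
      sub_sub_sub_cancel_right]
    refine (abs_norm_rpow_sub_norm_rpow_le hp.le (hR s _ _ (by simpa [Real.dist_eq] using hs) h1 h2)
      (hR s' _ _ (by simpa [Real.dist_eq] using hs') h1 h2)).trans ?_
    rw [add_sub_add_right_eq_sub, ← sub_smul, norm_smul, Real.norm_eq_abs, mul_assoc _ Z,
      mul_comm Z]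
    gcongr

/-- Convergence of the pairings `⟨J_p (σ z + x n) - J_p (x n), x n⟩` for all scales `σ` gives
convergence of the increments `‖z + x n‖ ^ p - ‖x n‖ ^ p`. -/
theorem UniformlySmooth.tendsto_integral_norm_add_rpow_sub {E Ω : Type*}
    [NormedAddCommGroup E] [NormedSpace ℝ E] (h : UniformlySmooth E) {p : ℝ} (hp : 1 < p)
    [MeasurableSpace Ω] {μ : Measure Ω} [IsFiniteMeasure μ] {x : ℕ → Ω → E} {y z : Ω → E}
    {M Z : ℝ} (hM : 0 ≤ M) (hZ : 0 ≤ Z) (hx : ∀ n, AEStronglyMeasurable (x n) μ)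
    (hy : AEStronglyMeasurable y μ) (hz : AEStronglyMeasurable z μ)
    (hxM : ∀ n, ∀ᵐ t ∂μ, ‖x n t‖ ≤ M) (hyM : ∀ᵐ t ∂μ, ‖y t‖ ≤ M) (hzZ : ∀ᵐ t ∂μ, ‖z t‖ ≤ Z)
    (hlim : ∀ σ : ℝ, 0 < σ → Tendsto
      (fun n => ∫ t, (dualMapJ p (σ • z t + x n t) - dualMapJ p (x n t)) (x n t) ∂μ) atTop
      (𝓝 (∫ t, (dualMapJ p (σ • z t + y t) - dualMapJ p (y t)) (y t) ∂μ))) :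
    Tendsto (fun n => ∫ t, (‖z t + x n t‖ ^ p - ‖x n t‖ ^ p) ∂μ) atTop
      (𝓝 (∫ t, (‖z t + y t‖ ^ p - ‖y t‖ ^ p) ∂μ)) := by
  set Φ : (Ω → E) → ℝ → ℝ := fun v s => ∫ t, (‖s • z t + v t‖ ^ p - ‖v t‖ ^ p) ∂μ with hΦ
  set H : (Ω → E) → ℝ → ℝ := fun v s =>
    ∫ t, (dualMapJ p (s • z t + v t) - dualMapJ p (v t)) (v t) ∂μ with hH
  have hnorm : ∀ s : ℝ, ∀ v w : E, 0 ≤ s → ‖v‖ ≤ M → ‖w‖ ≤ Z → ‖s • w + v‖ ≤ s * Z + M := by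
    intro s v w hs hv hw
    calc ‖s • w + v‖ ≤ s * ‖w‖ + ‖v‖ := by
          simpa [norm_smul, abs_of_nonneg hs] using norm_add_le (s • w) v
      _ ≤ s * Z + M := by gcongr
  have hΦd : ∀ v : Ω → E, AEStronglyMeasurable v μ → (∀ᵐ t ∂μ, ‖v t‖ ≤ M) → ∀ σ : ℝ, 0 < σ →
      HasDerivAt (Φ v) (p / σ * (Φ v σ - H v σ)) σ := fun v hv hvM σ hσ =>
    h.hasDerivAt_integral_norm_smul_add_rpow hp hM hZ hv hz hvM hzZ hσ.ne'
  have hHb : ∀ v : Ω → E, (∀ᵐ t ∂μ, ‖v t‖ ≤ M) → ∀ S σ : ℝ, 1 ≤ σ → σ ≤ S →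
      |H v σ| ≤ 2 * (S * Z + M + 1) ^ (p - 1) * M * μ.real univ := by
    intro v hvM S σ h1 hS
    refine (Real.norm_eq_abs _).symm.trans_le (norm_integral_le_of_norm_le_const ?_)
    filter_upwards [hvM, hzZ] with t ht1 ht2
    have hSZ : σ * Z ≤ S * Z := by gcongr
    have hSZ0 : 0 ≤ S * Z := mul_nonneg (by linarith) hZ
    have a1 : ‖dualMapJ p (σ • z t + v t)‖ ≤ (S * Z + M + 1) ^ (p - 1) :=
      norm_dualMapJ_le hp.le (by linarith [hnorm σ _ _ (by linarith) ht1 ht2])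
    have a2 : ‖dualMapJ p (v t)‖ ≤ (S * Z + M + 1) ^ (p - 1) :=
      norm_dualMapJ_le hp.le (by linarith)
    refine (ContinuousLinearMap.le_opNorm _ _).trans ?_
    have a3 := (norm_sub_le (dualMapJ p (σ • z t + v t)) (dualMapJ p (v t)))
    exact mul_le_mul (by linarith) ht1 (norm_nonneg _)
      (by linarith [norm_nonneg (dualMapJ p (v t))])
  have hFint : ∀ v : Ω → E, AEStronglyMeasurable v μ → (∀ᵐ t ∂μ, ‖v t‖ ≤ M) → ∀ σ : ℝ, 0 ≤ σ →
      Integrable (fun t => ‖σ • z t + v t‖ ^ p - ‖v t‖ ^ p) μ := by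
    intro v hv hvM σ hσ
    have hc : Continuous fun x : ℝ => x ^ p := Real.continuous_rpow_const (by linarith)
    refine Integrable.mono' (integrable_const (p * (σ * Z + M) ^ (p - 1) * (σ * Z)))
      ((hc.comp_aestronglyMeasurable ((hz.const_smul σ).add hv).norm).sub
      (hc.comp_aestronglyMeasurable hv.norm)) ?_
    filter_upwards [hvM, hzZ] with t h1 h2
    refine (abs_norm_rpow_sub_norm_rpow_le hp.le (hnorm σ _ _ hσ h1 h2)
      (by nlinarith)).trans ?_
    rw [add_sub_cancel_right, norm_smul, Real.norm_of_nonneg hσ]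
    gcongr
  have hDb : ∀ n σ, 1 ≤ σ → |Φ (x n) σ - Φ y σ|
      ≤ (p * (Z + M) ^ (p - 1) * (2 * M) + p * M ^ (p - 1) * (2 * M)) * μ.real univ
        * σ ^ (p - 1) := by
    intro n σ hσ
    have hσ0 : 0 ≤ σ := by linarith
    simp only [hΦ]
    rw [← integral_sub (hFint _ (hx n) (hxM n) σ hσ0) (hFint y hy hyM σ hσ0), mul_right_comm]
    refine (Real.norm_eq_abs _).symm.trans_le (norm_integral_le_of_norm_le_const ?_)
    filter_upwards [hxM n, hyM, hzZ] with t h1 h2 h3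
    have hd : ‖x n t - y t‖ ≤ 2 * M := (norm_sub_le _ _).trans (by linarith)
    have hσ1 : 1 ≤ σ ^ (p - 1) := Real.one_le_rpow hσ (by linarith)
    have b1 : |‖σ • z t + x n t‖ ^ p - ‖σ • z t + y t‖ ^ p|
        ≤ p * (Z + M) ^ (p - 1) * (2 * M) * σ ^ (p - 1) := by
      have hle : σ * Z + M ≤ σ * (Z + M) := by nlinarith
      refine (abs_norm_rpow_sub_norm_rpow_le hp.le ((hnorm σ _ _ hσ0 h1 h3).trans hle)
        ((hnorm σ _ _ hσ0 h2 h3).trans hle)).trans ?_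
      rw [add_sub_add_left_eq_sub, Real.mul_rpow hσ0 (by linarith)]
      calc p * (σ ^ (p - 1) * (Z + M) ^ (p - 1)) * ‖x n t - y t‖
          ≤ p * (σ ^ (p - 1) * (Z + M) ^ (p - 1)) * (2 * M) := by gcongr
        _ = _ := by ring
    have b2 : |‖x n t‖ ^ p - ‖y t‖ ^ p| ≤ p * M ^ (p - 1) * (2 * M) * σ ^ (p - 1) := by
      refine (abs_norm_rpow_sub_norm_rpow_le hp.le h1 h2).trans ?_
      calc p * M ^ (p - 1) * ‖x n t - y t‖ ≤ p * M ^ (p - 1) * (2 * M) := by gcongr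
        _ ≤ _ := le_mul_of_one_le_right (by positivity) hσ1
    rw [Real.norm_eq_abs, sub_sub_sub_comm, add_mul]
    exact (abs_sub _ _).trans (add_le_add b1 b2)
  have key := tendsto_zero_of_hasDerivAt_div_mul_sub (p := p) (by linarith)
    (D := fun n σ => Φ (x n) σ - Φ y σ) (E := fun n σ => H (x n) σ - H y σ)
    (b := fun S => 2 * (2 * (S * Z + M + 1) ^ (p - 1) * M * μ.real univ))
    (fun n σ hσ => ((hΦd _ (hx n) (hxM n) σ hσ).sub (hΦd y hy hyM σ hσ)).congr_deriv (by ring))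
    (fun σ hσ => by
      have := (hlim σ hσ).sub_const (H y σ)
      rwa [sub_self] at this)
    (fun n S σ h1 hS => (abs_sub _ _).trans
      (by linarith [hHb _ (hxM n) S σ h1 hS, hHb y hyM S σ h1 hS])) hDb
  have := key.add_const (Φ y 1)
  simpa [hΦ] using this

theorem mem_projSet_iff {E : Type*} [NormedAddCommGroup E] {C : Set E} {x y : E} :
    x ∈ projSet C y ↔ x ∈ C ∧ ∀ c ∈ C, ‖y - x‖ ≤ ‖y - c‖ := by
  constructor
  · rintro ⟨hx, h⟩
    refine ⟨hx, fun c hc => ?_⟩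
    rw [h, ← dist_eq_norm]
    exact Metric.infDist_le_dist_of_mem hc
  · rintro ⟨hx, h⟩
    refine ⟨hx, le_antisymm ?_ ?_⟩
    · rw [Metric.le_infDist ⟨x, hx⟩]
      intro c hc
      rw [dist_eq_norm]
      exact h c hc
    · rw [← dist_eq_norm]
      exact Metric.infDist_le_dist_of_mem hx

theorem mem_gammaSet_iff {E : Type*} [NormedAddCommGroup E] [NormedSpace ℝ E] {r : ℝ}
    {C : Set E} {x v : E} :
    v ∈ gammaSet r C x ↔ x ∈ C ∧ ∀ c ∈ C, ‖r • v‖ ≤ ‖x - c + r • v‖ := by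
  simp only [gammaSet, mem_ofPred_eq, mem_projSet_iff, add_sub_cancel_left, add_sub_right_comm]

theorem gammaSet_mono {E : Type*} [NormedAddCommGroup E] [NormedSpace ℝ E] {r s lam : ℝ}
    {C : Set E} {x v w : E} (hv : v ∈ gammaSet r C x) (h0 : 0 ≤ lam) (h1 : lam ≤ 1)
    (hw : s • w = lam • r • v) : w ∈ gammaSet s C x := by
  rw [mem_gammaSet_iff] at hv ⊢
  refine ⟨hv.1, fun c hc => ?_⟩
  have h2 := hv.2 c hc
  have h3 : ‖x - c + r • v‖ ≤ ‖x - c + s • w‖ + (1 - lam) * ‖r • v‖ := by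
    have : x - c + r • v = (x - c + s • w) + (1 - lam) • r • v := by
      rw [hw, sub_smul, one_smul]; abel
    rw [this]
    refine (norm_add_le _ _).trans ?_
    rw [norm_smul (1 - lam), Real.norm_of_nonneg (by linarith)]
  have h4 : ‖s • w‖ = lam * ‖r • v‖ := by
    rw [hw, norm_smul, Real.norm_of_nonneg h0]
  linarith

/-- One step of the catching-up algorithm. -/
theorem DirProxRegular.exists_step {E : Type*} [NormedAddCommGroup E] [NormedSpace ℝ E]
    {r : ℝ} {f : E → E} {C : Set E} (hC : DirProxRegular r f C) (hr : 0 < r) {M : ℝ}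
    (hf : ∀ x, ‖f x‖ ≤ M) {h : ℝ} (hh : 0 < h) (hhr : h * (M + 1) < r) {x : E} (hx : x ∈ C) :
    ∃ z d : E, z ∈ C ∧ z = x + h • (f x - d) ∧ ‖d‖ ≤ M ∧ d ∈ gammaSet (r / (M + 1)) C z := by
  have hM : 0 ≤ M := (norm_nonneg _).trans (hf x)
  have h_zero : ∀ z ∈ C, (0 : E) ∈ gammaSet (r / (M + 1)) C z := by
    intro z hz
    rw [mem_gammaSet_iff]
    simp [hz]
  by_cases h0 : f x = 0
  · exact ⟨x, 0, hx, by simp [h0], by simpa using hM, h_zero x hx⟩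
  have hn : 0 < ‖f x‖ := norm_pos_iff.2 h0
  have hlt : h * ‖f x‖ < r := by nlinarith [hf x]
  obtain ⟨z, hz, hzg⟩ := hC x hx (h * ‖f x‖) (mul_pos hh hn) hlt
  rw [mul_assoc, mul_inv_cancel₀ hn.ne', mul_one] at hz hzg
  have hzP : z ∈ projSet C (x + h • f x) := by rw [hz]; exact mem_singleton z
  rw [mem_projSet_iff] at hzP
  set v := x + h • f x - z with hv
  have hvn : ‖v‖ ≤ h * ‖f x‖ := by
    have := hzP.2 x hx
    rwa [add_sub_cancel_left, norm_smul, Real.norm_of_nonneg hh.le] at this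
  have hvM : ‖v‖ ≤ h * M := hvn.trans (by gcongr; exact hf x)
  refine ⟨z, h⁻¹ • v, hzP.1, ?_, ?_, ?_⟩
  · rw [smul_sub, smul_inv_smul₀ hh.ne', hv]; abel
  · rw [norm_smul, norm_inv, Real.norm_of_nonneg hh.le, inv_mul_le_iff₀ hh]
    exact hvM
  · by_cases hv0 : v = 0
    · rw [hv0, smul_zero]
      exact h_zero z hzP.1
    have hvpos : 0 < ‖v‖ := norm_pos_iff.2 hv0
    refine gammaSet_mono hzg (lam := ‖v‖ / (h * (M + 1))) (by positivity) ?_ ?_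
    · rw [div_le_one (by positivity)]
      nlinarith
    · rw [smul_smul, smul_smul, smul_smul]
      congr 1
      field_simp

/-- The catching-up algorithm: `U (i + 1)` is the projection of `U i + h f (U i)` and `D i` the
rescaled defect of this projection. -/
theorem DirProxRegular.exists_discrete {E : Type*} [NormedAddCommGroup E] [NormedSpace ℝ E]
    {r : ℝ} {f : E → E} {C : Set E} (hC : DirProxRegular r f C) (hr : 0 < r) {M : ℝ}
    (hf : ∀ x, ‖f x‖ ≤ M) {h : ℝ} (hh : 0 < h) (hhr : h * (M + 1) < r) {x : E} (hx : x ∈ C) :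
    ∃ U D : ℕ → E, U 0 = x ∧ (∀ i, U i ∈ C) ∧
      (∀ i, U (i + 1) = U i + h • (f (U i) - D i)) ∧ (∀ i, ‖D i‖ ≤ M) ∧
      ∀ i, D i ∈ gammaSet (r / (M + 1)) C (U (i + 1)) := by
  choose z d hz hzd hd hg using
    fun x : C => hC.exists_step hr hf hh hhr x.2
  let V : ℕ → C := fun i => Nat.rec ⟨x, hx⟩ (fun _ y => ⟨z y, hz y⟩) i
  refine ⟨fun i => (V i).1, fun i => d (V i), rfl, fun i => (V i).2, ?_, ?_, ?_⟩
  exacts [fun i => hzd (V i), fun i => hd (V i), fun i => hg (V i)]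

theorem norm_sub_le_of_norm_succ_sub_le {E : Type*} [NormedAddCommGroup E] {U : ℕ → E} {L : ℝ}
    (hU : ∀ i, ‖U (i + 1) - U i‖ ≤ L) (i j : ℕ) : ‖U i - U j‖ ≤ L * |(i : ℝ) - j| := by
  wlog hij : i ≤ j generalizing i j
  · rw [norm_sub_rev, abs_sub_comm]
    exact this j i (le_of_not_ge hij)
  have := dist_le_Ico_sum_of_dist_le hij (f := U) (d := fun _ => L) fun {k} _ _ => by
    rw [dist_comm, dist_eq_norm]
    exact hU k
  rw [Finset.sum_const, Nat.card_Ico, nsmul_eq_mul, Nat.cast_sub hij, dist_eq_norm] at this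
  rw [abs_sub_comm, abs_of_nonneg (sub_nonneg.2 (Nat.cast_le.2 hij))]
  linarith

theorem abs_natFloor_sub_natFloor_le (a b : ℝ) :
    |((⌊a⌋₊ : ℕ) : ℝ) - (⌊b⌋₊ : ℕ)| ≤ |a - b| + 1 := by
  wlog hab : a ≤ b generalizing a b
  · rw [abs_sub_comm, abs_sub_comm a]
    exact this b a (le_of_not_ge hab)
  have h1 : (⌊a⌋₊ : ℝ) ≤ ⌊b⌋₊ := Nat.cast_le.2 (Nat.floor_mono hab)
  rw [abs_sub_comm, abs_sub_comm a, abs_of_nonneg (by linarith), abs_of_nonneg (by linarith)]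
  rcases le_or_gt 0 b with hb | hb
  · linarith [Nat.floor_le hb, Nat.lt_floor_add_one a]
  · rw [Nat.floor_of_nonpos hb.le]
    have : (0 : ℝ) ≤ ⌊a⌋₊ := Nat.cast_nonneg _
    push_cast
    linarith

theorem norm_floor_sub_floor_le {E : Type*} [NormedAddCommGroup E] {U : ℕ → E} {L h : ℝ}
    (hh : 0 < h) (hU : ∀ i, ‖U (i + 1) - U i‖ ≤ h * L) (t s : ℝ) :
    ‖U ⌊t / h⌋₊ - U ⌊s / h⌋₊‖ ≤ L * (|t - s| + h) := by
  have hL : 0 ≤ h * L := (norm_nonneg _).trans (hU 0)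
  refine (norm_sub_le_of_norm_succ_sub_le hU _ _).trans ?_
  refine (mul_le_mul_of_nonneg_left (abs_natFloor_sub_natFloor_le _ _) hL).trans_eq ?_
  rw [← sub_div, abs_div, abs_of_pos hh]
  field_simp

/-- A recursion with steps `h • G i` is, up to one step, the integral of the piecewise constant
function attached to `G`. -/
theorem norm_floor_sub_integral_le {E : Type*} [NormedAddCommGroup E] [NormedSpace ℝ E]
    [CompleteSpace E] {U G : ℕ → E} {L h : ℝ} (hh : 0 < h)
    (hU : ∀ i, U (i + 1) = U i + h • G i) (hG : ∀ i, ‖G i‖ ≤ L) {t : ℝ} (ht : 0 ≤ t) :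
    ‖U ⌊t / h⌋₊ - U 0 - ∫ s in (0 : ℝ)..t, G ⌊s / h⌋₊‖ ≤ L * h := by
  have hint : ∀ a b : ℝ, IntervalIntegrable (fun s => G ⌊s / h⌋₊) volume a b := by
    intro a b
    have hm : StronglyMeasurable fun s : ℝ => G ⌊s / h⌋₊ :=
      StronglyMeasurable.of_discrete.comp_measurable
        (Nat.measurable_floor.comp (measurable_id.div_const h))
    exact (intervalIntegrable_const (c := L)).mono_fun hm.aestronglyMeasurable
      (ae_of_all _ fun s => (hG _).trans (Real.le_norm_self _))
  have hstep : ∀ i : ℕ, ∫ s in (i * h : ℝ)..((i + 1 : ℕ) * h : ℝ), G ⌊s / h⌋₊ = h • G i := by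
    intro i
    have hle : (i * h : ℝ) ≤ ((i + 1 : ℕ) * h : ℝ) := by push_cast; nlinarith
    have : ∫ s in (i * h : ℝ)..((i + 1 : ℕ) * h : ℝ), G ⌊s / h⌋₊
        = ∫ s in (i * h : ℝ)..((i + 1 : ℕ) * h : ℝ), G i := by
      refine intervalIntegral.integral_congr_ae ?_
      filter_upwards [Measure.ae_ne volume (((i + 1 : ℕ) : ℝ) * h)] with s hne hs
      rw [uIoc_of_le hle] at hs
      have hs2 := lt_of_le_of_ne hs.2 hne
      rw [(Nat.floor_eq_iff (div_nonneg (by nlinarith [hs.1, i.cast_nonneg (α := ℝ)]) hh.le)).2]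
      constructor
      · rw [le_div_iff₀ hh]; exact hs.1.le
      · rw [div_lt_iff₀ hh]; push_cast at hs2; exact hs2
    rw [this, intervalIntegral.integral_const]
    congr 1
    push_cast
    ring
  have hsum : ∀ i : ℕ, ∫ s in (0 : ℝ)..(i * h : ℝ), G ⌊s / h⌋₊ = U i - U 0 := by
    intro i
    induction i with
    | zero => simp
    | succ i ih =>
      rw [← intervalIntegral.integral_add_adjacent_intervals (hint 0 (i * h)) (hint _ _), ih,
        hstep, hU]
      abel
  set m := ⌊t / h⌋₊ with hm
  have hm1 : (m : ℝ) * h ≤ t := by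
    rw [← le_div_iff₀ hh]; exact Nat.floor_le (div_nonneg ht hh.le)
  have hm2 : t < (m + 1) * h := by
    rw [← div_lt_iff₀ hh]; exact Nat.lt_floor_add_one _
  rw [← intervalIntegral.integral_add_adjacent_intervals (hint 0 (m * h)) (hint _ _), hsum,
    sub_add_cancel_left, norm_neg]
  refine (intervalIntegral.norm_integral_le_of_norm_le_const fun s _ => hG _).trans ?_
  refine mul_le_mul_of_nonneg_left ?_ ((norm_nonneg _).trans (hG 0))
  rw [abs_of_nonneg (by linarith)]
  linarith

/-- A form of the Arzelà–Ascoli theorem for functions which are Lipschitz up to an error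
tending to zero and take values in a ball-compact set. -/
theorem BallCompact.exists_subseq_tendsto {E : Type*} [NormedAddCommGroup E] [CompleteSpace E]
    {C : Set E} (hC : BallCompact C) {X : ℕ → ℝ → E} {L : ℝ} {h : ℕ → ℝ} {x₀ : E}
    (hL : 0 ≤ L) (hX : ∀ n t, X n t ∈ C) (hX0 : ∀ n, X n 0 = x₀)
    (hLip : ∀ n t s, ‖X n t - X n s‖ ≤ L * (|t - s| + h n)) (hh : Tendsto h atTop (𝓝 0))
    (hh1 : ∀ n, h n ≤ 1) :
    ∃ φ : ℕ → ℕ, StrictMono φ ∧ ∃ u : ℝ → E, Continuous u ∧ (∀ t, u t ∈ C) ∧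
      ∀ t, Tendsto (fun n => X (φ n) t) atTop (𝓝 (u t)) := by
  have hK : ∀ n t, X n t ∈ C ∩ Metric.closedBall x₀ (L * (|t| + 1)) := by
    intro n t
    refine ⟨hX n t, ?_⟩
    rw [mem_closedBall_iff_norm, ← hX0 n]
    refine (hLip n t 0).trans ?_
    rw [sub_zero]
    have := hh1 n
    gcongr
  have hcomp : IsCompact (Set.univ.pi fun q : ℚ =>
      C ∩ Metric.closedBall x₀ (L * (|(q : ℝ)| + 1))) := isCompact_univ_pi fun q => hC _ _
  obtain ⟨a, -, φ, hφ, ha⟩ := hcomp.isSeqCompact (x := fun n (q : ℚ) => X n q)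
    (fun n q _ => hK n q)
  rw [tendsto_pi_nhds] at ha
  have hhφ : Tendsto (fun n => h (φ n)) atTop (𝓝 0) := hh.comp hφ.tendsto_atTop
  have hcau : ∀ t, CauchySeq fun n => X (φ n) t := by
    intro t
    rw [Metric.cauchySeq_iff]
    intro ε hε
    have hL1 : 0 < L + 1 := by linarith
    set η := ε / (8 * (L + 1)) with hη
    have hη0 : 0 < η := by positivity
    have hLη : (L + 1) * η = ε / 8 := by rw [hη]; field_simp
    obtain ⟨q, hq⟩ := exists_rat_near t hη0
    obtain ⟨N1, hN1⟩ := Metric.cauchySeq_iff.1 (ha q).cauchySeq (ε / 4) (by linarith)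
    obtain ⟨N2, hN2⟩ := eventually_atTop.1 (hhφ.eventually (gt_mem_nhds hη0))
    have hclose : ∀ n, N2 ≤ n → dist (X (φ n) t) (X (φ n) q) ≤ ε / 4 := by
      intro n hn
      rw [dist_eq_norm]
      refine (hLip _ _ _).trans ?_
      calc L * (|t - q| + h (φ n)) ≤ L * (η + η) := by gcongr; exact (hN2 n hn).le
        _ ≤ ε / 4 := by nlinarith
    refine ⟨max N1 N2, fun m hm n hn => ?_⟩
    have e1 := hclose m (le_trans (le_max_right _ _) hm)
    have e2 := hclose n (le_trans (le_max_right _ _) hn)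
    have e3 : dist (X (φ m) q) (X (φ n) q) < ε / 4 :=
      hN1 m (le_trans (le_max_left _ _) hm) n (le_trans (le_max_left _ _) hn)
    have e4 := dist_triangle4 (X (φ m) t) (X (φ m) q) (X (φ n) q) (X (φ n) t)
    rw [dist_comm (X (φ n) q)] at e4
    linarith
  choose u hu using fun t => cauchySeq_tendsto_of_complete (hcau t)
  refine ⟨φ, hφ, u, ?_, fun t => ?_, hu⟩
  · refine (LipschitzWith.of_dist_le_mul (K := L.toNNReal) fun t s => ?_).continuous
    rw [Real.coe_toNNReal L hL, dist_eq_norm, Real.dist_eq]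
    refine le_of_tendsto_of_tendsto' ((hu t).sub (hu s)).norm
      (g := fun n => L * (|t - s| + h (φ n))) ?_ fun n => hLip _ _ _
    simpa using (hhφ.const_add |t - s|).const_mul L
  · exact ((hC x₀ (L * (|t| + 1))).isClosed.mem_of_tendsto (hu t)
      (Eventually.of_forall fun n => hK (φ n) t)).1

theorem integrable_norm_rpow_of_bound {E Ω : Type*} [NormedAddCommGroup E] [MeasurableSpace Ω]
    {μ : Measure Ω} [IsFiniteMeasure μ] {v : Ω → E} {p R : ℝ} (hp : 0 ≤ p)
    (hv : AEStronglyMeasurable v μ) (hvR : ∀ᵐ t ∂μ, ‖v t‖ ≤ R) :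
    Integrable (fun t => ‖v t‖ ^ p) μ := by
  refine Integrable.of_bound
    ((Real.continuous_rpow_const hp).comp_aestronglyMeasurable hv.norm) (R ^ p) ?_
  filter_upwards [hvR] with t ht
  rw [Real.norm_of_nonneg (Real.rpow_nonneg (norm_nonneg _) _)]
  exact Real.rpow_le_rpow (norm_nonneg _) ht hp

theorem UniformlySmooth.ae_norm_le_norm_add {E Ω : Type*}
    [NormedAddCommGroup E] [NormedSpace ℝ E] (h : UniformlySmooth E) {p : ℝ} (hp : 1 < p)
    [MeasurableSpace Ω] {μ : Measure Ω} [IsFiniteMeasure μ] {x w : ℕ → Ω → E} {y z : Ω → E}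
    {M Z : ℝ} (hM : 0 ≤ M) (hZ : 0 ≤ Z) (hx : ∀ n, AEStronglyMeasurable (x n) μ)
    (hw : ∀ n, AEStronglyMeasurable (w n) μ)
    (hy : AEStronglyMeasurable y μ) (hz : AEStronglyMeasurable z μ)
    (hxM : ∀ n, ∀ᵐ t ∂μ, ‖x n t‖ ≤ M) (hyM : ∀ᵐ t ∂μ, ‖y t‖ ≤ M)
    (hwZ : ∀ n, ∀ᵐ t ∂μ, ‖w n t‖ ≤ Z) (hzZ : ∀ᵐ t ∂μ, ‖z t‖ ≤ Z)
    (hwz : ∀ᵐ t ∂μ, Tendsto (fun n => w n t) atTop (𝓝 (z t)))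
    (hlim : ∀ A, MeasurableSet A → ∀ σ : ℝ, 0 < σ → Tendsto
      (fun n => ∫ t in A, (dualMapJ p (σ • z t + x n t) - dualMapJ p (x n t)) (x n t) ∂μ) atTop
      (𝓝 (∫ t in A, (dualMapJ p (σ • z t + y t) - dualMapJ p (y t)) (y t) ∂μ)))
    (hle : ∀ n, ∀ᵐ t ∂μ, ‖x n t‖ ≤ ‖w n t + x n t‖) :
    ∀ᵐ t ∂μ, ‖y t‖ ≤ ‖z t + y t‖ := by
  have hp0 : 0 < p := by linarith
  have hsum : ∀ a b : Ω → E, AEStronglyMeasurable a μ → AEStronglyMeasurable b μ →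
      (∀ᵐ t ∂μ, ‖a t‖ ≤ Z) → (∀ᵐ t ∂μ, ‖b t‖ ≤ M) →
      Integrable (fun t => ‖a t + b t‖ ^ p) μ := by
    intro a b ha hb haZ hbM
    refine integrable_norm_rpow_of_bound (R := Z + M) hp0.le (ha.add hb) ?_
    filter_upwards [haZ, hbM] with t h1 h2
    exact (norm_add_le _ _).trans (add_le_add h1 h2)
  have hxi : ∀ n, Integrable (fun t => ‖x n t‖ ^ p) μ := fun n =>
    integrable_norm_rpow_of_bound hp0.le (hx n) (hxM n)
  have hyi : Integrable (fun t => ‖y t‖ ^ p) μ :=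
    integrable_norm_rpow_of_bound hp0.le hy hyM
  have key : 0 ≤ᵐ[μ] fun t => ‖z t + y t‖ ^ p - ‖y t‖ ^ p := by
    refine ae_nonneg_of_forall_setIntegral_nonneg ((hsum z y hz hy hzZ hyM).sub hyi) ?_
    intro A hA _
    have h1 : Tendsto (fun n => ∫ t in A, (‖z t + x n t‖ ^ p - ‖x n t‖ ^ p) ∂μ) atTop
        (𝓝 (∫ t in A, (‖z t + y t‖ ^ p - ‖y t‖ ^ p) ∂μ)) :=
      h.tendsto_integral_norm_add_rpow_sub hp hM hZ (fun n => (hx n).restrict) hy.restrict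
        hz.restrict (fun n => ae_restrict_of_ae (hxM n)) (ae_restrict_of_ae hyM)
        (ae_restrict_of_ae hzZ) (hlim A hA)
    have h2 : Tendsto (fun n => ∫ t in A, (‖z t + x n t‖ ^ p - ‖w n t + x n t‖ ^ p) ∂μ) atTop
        (𝓝 (∫ _ in A, (0 : ℝ) ∂μ)) := by
      have hb : ∀ n, ∀ᵐ t ∂μ, ‖‖z t + x n t‖ ^ p - ‖w n t + x n t‖ ^ p‖
          ≤ p * (Z + M) ^ (p - 1) * ‖z t - w n t‖ := by
        intro n
        filter_upwards [hxM n, hwZ n, hzZ] with t a1 a2 a3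
        rw [← add_sub_add_right_eq_sub (z t) (w n t) (x n t)]
        exact abs_norm_rpow_sub_norm_rpow_le hp.le
          ((norm_add_le _ _).trans (add_le_add a3 a1))
          ((norm_add_le _ _).trans (add_le_add a2 a1))
      refine tendsto_integral_of_dominated_convergence
        (fun _ => p * (Z + M) ^ (p - 1) * (2 * Z))
        (fun n => ((hsum z _ hz (hx n) hzZ (hxM n)).sub
          (hsum _ _ (hw n) (hx n) (hwZ n) (hxM n))).1.restrict) (integrable_const _)
        (fun n => ae_restrict_of_ae ?_) (ae_restrict_of_ae ?_)
      · filter_upwards [hb n, hwZ n, hzZ] with t a1 a2 a3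
        refine a1.trans ?_
        have : ‖z t - w n t‖ ≤ 2 * Z := (norm_sub_le _ _).trans (by linarith)
        gcongr
      · filter_upwards [ae_all_iff.2 hb, hwz] with t a1 a2
        refine squeeze_zero_norm a1 ?_
        simpa using ((a2.const_sub (z t)).norm).const_mul (p * (Z + M) ^ (p - 1))
    rw [integral_zero] at h2
    refine le_of_tendsto_of_tendsto' h2 h1 fun n => ?_
    refine integral_mono_ae
      ((hsum z _ hz (hx n) hzZ (hxM n)).sub (hsum _ _ (hw n) (hx n) (hwZ n) (hxM n))).restrict
      ((hsum z _ hz (hx n) hzZ (hxM n)).sub (hxi n)).restrict (ae_restrict_of_ae ?_)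
    filter_upwards [hle n] with t ht
    exact sub_le_sub_left (Real.rpow_le_rpow (norm_nonneg _) ht hp0.le) _
  filter_upwards [key] with t ht
  exact (Real.rpow_le_rpow_iff (norm_nonneg _) (norm_nonneg _) hp0).1 (sub_nonneg.1 ht)

/-- Norm bounds are stable under weak-* limits. -/
theorem ae_norm_le_of_tendsto_setIntegral_dual {E Ω : Type*} [NormedAddCommGroup E]
    [NormedSpace ℝ E] [TopologicalSpace.SeparableSpace E] [MeasurableSpace Ω] {μ : Measure Ω}
    [IsFiniteMeasure μ] {x : ℕ → Ω → E} {y : Ω → E} {M : ℝ}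
    (hx : ∀ n, Integrable (x n) μ) (hy : Integrable y μ)
    (hxM : ∀ n, ∀ᵐ t ∂μ, ‖x n t‖ ≤ M)
    (hlim : ∀ (l : E →L[ℝ] ℝ) (A : Set Ω), MeasurableSet A →
      Tendsto (fun n => ∫ t in A, l (x n t) ∂μ) atTop (𝓝 (∫ t in A, l (y t) ∂μ))) :
    ∀ᵐ t ∂μ, ‖y t‖ ≤ M := by
  have hdual : ∀ l : E →L[ℝ] ℝ, ‖l‖ ≤ 1 → ∀ᵐ t ∂μ, l (y t) ≤ M := by
    intro l hl
    refine ae_le_of_forall_setIntegral_le (l.integrable_comp hy) (integrable_const M) ?_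
    intro A hA _
    refine le_of_tendsto' (hlim l A hA) fun n => ?_
    refine integral_mono_ae (l.integrable_comp (hx n)).restrict (integrable_const M)
      (ae_restrict_of_ae ?_)
    filter_upwards [hxM n] with t ht
    calc l (x n t) ≤ ‖l (x n t)‖ := Real.le_norm_self _
      _ ≤ 1 * ‖x n t‖ := l.le_of_opNorm_le hl _
      _ ≤ M := by rwa [one_mul]
  choose l hl1 hl using fun v : E => exists_dual_vector'' ℝ v
  have hall : ∀ᵐ t ∂μ, ∀ k : ℕ, l (TopologicalSpace.denseSeq E k) (y t) ≤ M :=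
    ae_all_iff.2 fun k => hdual _ (hl1 _)
  filter_upwards [hall] with t ht
  refine le_of_forall_pos_le_add fun ε hε => ?_
  obtain ⟨k, hk⟩ := (TopologicalSpace.denseRange_denseSeq E).exists_dist_lt (y t)
    (half_pos hε)
  set d := TopologicalSpace.denseSeq E k
  have h1 : l d d = ‖d‖ := by simpa using hl d
  have h2 : l d (d - y t) ≤ 1 * ‖d - y t‖ :=
    (Real.le_norm_self _).trans ((l d).le_of_opNorm_le (hl1 d) _)
  have h3 : ‖y t‖ ≤ ‖d‖ + ‖y t - d‖ := by simpa using norm_add_le d (y t - d)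
  rw [map_sub] at h2
  rw [dist_eq_norm] at hk
  rw [norm_sub_rev] at h2
  linarith [ht k]

/-- **Sweeping process in a Banach space, constant set, bounded perturbation.** Let `B`
be a separable, reflexive, uniformly smooth Banach space which is `I`-smoothly weakly
compact for an exponent `p ∈ [2,∞)`, `f : B → B` bounded and continuous, `r > 0`, and
`C ⊂ B` nonempty, ball-compact and `(r,f)`-prox-regular. Then for every `u₀ ∈ C` the
sweeping process `u̇(t) + N(C,u(t)) ∋ f(u(t))`, `u(0) = u₀`, has an absolutely continuous
solution living in `C`, whose velocity moreover satisfies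
`‖u̇(t) - f(u(t))‖ ≤ ‖f‖_∞` a.e. on `I`. -/
theorem sweeping_process_banach_constant_bounded
    {B : Type*} [NormedAddCommGroup B] [NormedSpace ℝ B] [CompleteSpace B]
    [TopologicalSpace.SeparableSpace B]
    (hrefl : ReflexiveSpace B) (hsmooth : UniformlySmooth B)
    (T : ℝ) (hT : 0 < T) (p : ℝ) (hp : 2 ≤ p)
    (hiswc : ISmoothlyWeaklyCompact (Set.Icc 0 T) B p)
    (f : B → B) (hfcont : Continuous f) (hfbdd : ∃ M : ℝ, ∀ x, ‖f x‖ ≤ M)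
    (r : ℝ) (hr : 0 < r)
    (C : Set B) (hCne : C.Nonempty) (hCbc : BallCompact C)
    (hCprox : DirProxRegular r f C)
    (u₀ : B) (hu₀ : u₀ ∈ C) :
    ∃ u g : ℝ → B, IntegrableOn g (Set.Icc 0 T) ∧
      (∀ t ∈ Set.Icc (0:ℝ) T, u t = u₀ + ∫ s in (0:ℝ)..t, g s) ∧
      (∀ t ∈ Set.Icc (0:ℝ) T, u t ∈ C) ∧
      (∀ᵐ t ∂volume.restrict (Set.Icc (0:ℝ) T),
        f (u t) - g t ∈ proxNormalCone C (u t)) ∧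
      (∀ᵐ t ∂volume.restrict (Set.Icc (0:ℝ) T),
        ‖g t - f (u t)‖ ≤ ⨆ x : B, ‖f x‖) := by
  set M : ℝ := ⨆ x : B, ‖f x‖ with hMdef
  have hfM : ∀ x, ‖f x‖ ≤ M := by
    obtain ⟨M', hM'⟩ := hfbdd
    exact fun x => le_ciSup (f := fun x => ‖f x‖) ⟨M', by rintro _ ⟨x, rfl⟩; exact hM' x⟩ x
  have hM : 0 ≤ M := (norm_nonneg _).trans (hfM u₀)
  set ρ : ℝ := r / (M + 1) with hρ
  have hρ0 : 0 < ρ := by positivity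
  set h₀ : ℝ := min 1 (ρ / 2) with hh₀
  have hh₀0 : 0 < h₀ := lt_min one_pos (half_pos hρ0)
  set h : ℕ → ℝ := fun n => h₀ * (1 / ((n : ℝ) + 1)) with hh
  have hpos : ∀ n, 0 < h n := fun n => by positivity
  have hle : ∀ n, h n ≤ h₀ := by
    intro n
    refine mul_le_of_le_one_right hh₀0.le ?_
    rw [div_le_one (by positivity)]
    linarith [n.cast_nonneg (α := ℝ)]
  have hh1 : ∀ n, h n ≤ 1 := fun n => (hle n).trans (min_le_left _ _)
  have hhr : ∀ n, h n * (M + 1) < r := by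
    intro n
    rw [← lt_div_iff₀ (by positivity)]
    exact ((hle n).trans (min_le_right _ _)).trans_lt (half_lt_self hρ0)
  have hlim0 : Tendsto h atTop (𝓝 0) := by
    have := (tendsto_one_div_add_atTop_nhds_zero_nat (𝕜 := ℝ)).const_mul h₀
    rwa [mul_zero] at this
  choose U D hU0 hUC hUs hDM hDg using
    fun n => hCprox.exists_discrete hr hfM (hpos n) (hhr n) hu₀
  have hG : ∀ n i, ‖f (U n i) - D n i‖ ≤ 2 * M := fun n i =>
    (norm_sub_le _ _).trans (by linarith [hfM (U n i), hDM n i])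
  have hUd : ∀ n i, ‖U n (i + 1) - U n i‖ ≤ h n * (2 * M) := by
    intro n i
    rw [hUs, add_sub_cancel_left, norm_smul, Real.norm_of_nonneg (hpos n).le]
    exact mul_le_mul_of_nonneg_left (hG n i) (hpos n).le
  have hstep : ∀ (n : ℕ) (V : ℕ → B), StronglyMeasurable fun t : ℝ => V ⌊t / h n⌋₊ :=
    fun n V => StronglyMeasurable.of_discrete.comp_measurable
      (Nat.measurable_floor.comp (measurable_id.div_const (h n)))
  obtain ⟨φ, hφ, u, hucont, huC, hu⟩ := hCbc.exists_subseq_tendsto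
    (X := fun n t => U n ⌊t / h n⌋₊) (x₀ := u₀) (L := 2 * M) (by positivity)
    (fun n t => hUC n _) (fun n => by simp [hU0]) (fun n => norm_floor_sub_floor_le (hpos n) (hUd n))
    hlim0 hh1
  set I : Set ℝ := Set.Icc 0 T with hI
  set μ : Measure ℝ := volume.restrict I with hμ
  obtain ⟨k, hk, y, hym, ⟨My, hyMy⟩, hweak, hJ⟩ := hiswc
    (fun n t => D (φ n) ⌊t / h (φ n)⌋₊) (fun n => (hstep _ _).aestronglyMeasurable)
    ⟨M, fun n => ae_of_all _ fun t => hDM _ _⟩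
  have hψ : Tendsto (fun n => φ (k n)) atTop atTop :=
    hφ.tendsto_atTop.comp hk.tendsto_atTop
  set x : ℕ → ℝ → B := fun n t => D (φ (k n)) ⌊t / h (φ (k n))⌋₊ with hx
  set X : ℕ → ℝ → B := fun n t => U (φ (k n)) ⌊t / h (φ (k n))⌋₊ with hX
  have hhk : Tendsto (fun n => h (φ (k n))) atTop (𝓝 0) := hlim0.comp hψ
  have hXu : ∀ t, Tendsto (fun n => X n t) atTop (𝓝 (u t)) := fun t =>
    (hu t).comp hk.tendsto_atTop
  have hxm : ∀ n, StronglyMeasurable (x n) := fun n => hstep _ _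
  have hxM : ∀ n t, ‖x n t‖ ≤ M := fun n t => hDM _ _
  have hxint : ∀ n, Integrable (x n) μ := fun n =>
    Integrable.of_bound (hxm n).aestronglyMeasurable M (ae_of_all _ (hxM n))
  have hyint : Integrable y μ := Integrable.of_bound hym My hyMy
  have hweakA : ∀ (l : B →L[ℝ] ℝ) (A : Set ℝ), MeasurableSet A →
      Tendsto (fun n => ∫ t in A, l (x n t) ∂μ) atTop (𝓝 (∫ t in A, l (y t) ∂μ)) := by
    intro l A hA
    have e : ∀ v : ℝ → B, ∫ t, (A.indicator (fun _ => l) t) (v t) ∂μ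
        = ∫ t in A, l (v t) ∂μ := by
      intro v
      rw [← integral_indicator hA]
      congr 1 with t
      by_cases ht : t ∈ A <;> simp [ht]
    have := hweak (A.indicator fun _ => l) ((integrable_const l).indicator hA)
    rw [e] at this
    exact this.congr fun n => e _
  have hyM : ∀ᵐ t ∂μ, ‖y t‖ ≤ M := ae_norm_le_of_tendsto_setIntegral_dual hxint hyint
    (fun n => ae_of_all _ (hxM n)) hweakA
  have hfum : Continuous fun t => f (u t) := hfcont.comp hucont
  have hfuint : Integrable (fun t => f (u t)) μ :=
    Integrable.of_bound hfum.aestronglyMeasurable M (ae_of_all _ fun t => hfM _)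
  refine ⟨u, fun t => f (u t) - y t, hfuint.sub hyint, fun t ht => ?_, fun t _ => huC t, ?_, ?_⟩
  · have hsub : Ioc 0 t ⊆ I := fun s hs => ⟨hs.1.le, hs.2.trans ht.2⟩
    have hii : ∀ {F : Type _} [NormedAddCommGroup F] {v : ℝ → F}, Integrable v μ →
        IntervalIntegrable v volume 0 t := fun hv =>
      (intervalIntegrable_iff_integrableOn_Ioc_of_le ht.1).2 (IntegrableOn.mono_set hv hsub)
    have hfXm : ∀ n, StronglyMeasurable fun s => f (X n s) := fun n =>
      hfcont.comp_stronglyMeasurable (hstep _ _)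
    have hfXint : ∀ n, Integrable (fun s => f (X n s)) μ := fun n =>
      Integrable.of_bound (hfXm n).aestronglyMeasurable M (ae_of_all _ fun _ => hfM _)
    refine (SeparatingDual.eq_iff_forall_dual_eq (R := ℝ)).2 fun l => ?_
    have h1 : Tendsto (fun n => X n t - u₀ - ∫ s in (0 : ℝ)..t, (f (X n s) - x n s)) atTop
        (𝓝 0) := by
      refine squeeze_zero_norm (a := fun n => 2 * M * h (φ (k n))) (fun n => ?_)
        (by simpa using hhk.const_mul (2 * M))
      have := norm_floor_sub_integral_le (hpos (φ (k n))) (hUs (φ (k n))) (hG (φ (k n))) ht.1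
      rwa [hU0] at this
    have h2 : Tendsto (fun n => ∫ s in (0 : ℝ)..t, f (X n s)) atTop
        (𝓝 (∫ s in (0 : ℝ)..t, f (u s))) :=
      intervalIntegral.tendsto_integral_filter_of_dominated_convergence (fun _ => M)
        (Eventually.of_forall fun n => (hfXm n).aestronglyMeasurable)
        (Eventually.of_forall fun n => ae_of_all _ fun s _ => hfM _) intervalIntegrable_const
        (ae_of_all _ fun s _ => (hfcont.tendsto _).comp (hXu s))
    have h3 : Tendsto (fun n => l (∫ s in (0 : ℝ)..t, x n s)) atTop
        (𝓝 (l (∫ s in (0 : ℝ)..t, y s))) := by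
      have e : ∀ v : ℝ → B, Integrable v μ →
          ∫ s in Ioc 0 t, l (v s) ∂μ = l (∫ s in (0 : ℝ)..t, v s) := by
        intro v hv
        rw [hμ, Measure.restrict_restrict measurableSet_Ioc, inter_eq_left.2 hsub,
          ← intervalIntegral.integral_of_le ht.1, l.intervalIntegral_comp_comm (hii hv)]
      have := hweakA l (Ioc 0 t) measurableSet_Ioc
      rw [e y hyint] at this
      exact this.congr fun n => e _ (hxint n)
    have h4 : Tendsto
        (fun n => l (X n t - u₀ - ∫ s in (0 : ℝ)..t, (f (X n s) - x n s))) atTop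
        (𝓝 (l (u t) - l u₀ - (l (∫ s in (0 : ℝ)..t, f (u s)) - l (∫ s in (0 : ℝ)..t, y s)))) := by
      have := ((((l.continuous.tendsto _).comp (hXu t)).sub_const (l u₀)).sub
        (((l.continuous.tendsto _).comp h2).sub h3))
      refine this.congr fun n => ?_
      rw [intervalIntegral.integral_sub (hii (hfXint n)) (hii (hxint n))]
      simp
    have h5 := tendsto_nhds_unique h4 (((l.continuous.tendsto _).comp h1).congr fun _ => rfl)
    rw [intervalIntegral.integral_sub (hii hfuint) (hii hyint)]
    simp only [map_add, map_sub, map_zero] at h5 ⊢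
    linarith
  · have hC0 : Nonempty C := hCne.to_subtype
    have hpt : ∀ c ∈ C, ∀ᵐ t ∂μ, ‖ρ • y t‖ ≤ ‖u t - c + ρ • y t‖ := by
      intro c hc
      set Y : ℕ → ℝ → B := fun n t => U (φ (k n)) (⌊t / h (φ (k n))⌋₊ + 1) with hY
      have hYX : ∀ n t, ‖Y n t - X n t‖ ≤ h (φ (k n)) * (2 * M) := fun n t => hUd _ _
      have hYu : ∀ t, Tendsto (fun n => Y n t) atTop (𝓝 (u t)) := by
        intro t
        have h0 : Tendsto (fun n => Y n t - X n t) atTop (𝓝 0) :=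
          squeeze_zero_norm (fun n => hYX n t) (by simpa using hhk.mul_const (2 * M))
        simpa using h0.add (hXu t)
      set Z : ℝ := ρ⁻¹ * (2 * M + 2 * M * (T + 1) + ‖u₀ - c‖) with hZ
      have hYb : ∀ n, ∀ t ∈ I, ‖ρ⁻¹ • (Y n t - c)‖ ≤ Z := by
        intro n t ht
        rw [norm_smul, norm_inv, Real.norm_of_nonneg hρ0.le]
        refine mul_le_mul_of_nonneg_left ?_ (inv_nonneg.2 hρ0.le)
        have a1 : ‖Y n t - X n t‖ ≤ 2 * M := (hYX n t).trans
          (mul_le_of_le_one_left (by positivity) (hh1 _))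
        have a2 : ‖X n t - u₀‖ ≤ 2 * M * (T + 1) := by
          have := norm_floor_sub_floor_le (hpos (φ (k n))) (hUd (φ (k n))) t 0
          rw [zero_div, Nat.floor_zero, hU0, sub_zero, abs_of_nonneg ht.1] at this
          refine this.trans (mul_le_mul_of_nonneg_left ?_ (by positivity))
          linarith [ht.2, hh1 (φ (k n))]
        have e : Y n t - c = (Y n t - X n t) + (X n t - u₀) + (u₀ - c) := by abel
        rw [e]
        exact (norm_add₃_le).trans (by linarith)
      have hzlim : ∀ t, Tendsto (fun n => ρ⁻¹ • (Y n t - c)) atTop (𝓝 (ρ⁻¹ • (u t - c))) :=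
        fun t => ((hYu t).sub_const c).const_smul _
      have hzb : ∀ t ∈ I, ‖ρ⁻¹ • (u t - c)‖ ≤ Z := fun t ht =>
        le_of_tendsto' (hzlim t).norm fun n => hYb n t ht
      have hIm : ∀ {P : ℝ → Prop}, (∀ t ∈ I, P t) → ∀ᵐ t ∂μ, P t := fun hP =>
        (ae_restrict_iff' measurableSet_Icc).2 (ae_of_all _ hP)
      have hzm : AEStronglyMeasurable (fun t => ρ⁻¹ • (u t - c)) μ :=
        ((hucont.sub continuous_const).const_smul ρ⁻¹).aestronglyMeasurable
      have hZ0 : 0 ≤ Z := by positivity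
      have := hsmooth.ae_norm_le_norm_add (by linarith : 1 < p) (x := x) (y := y)
        (w := fun n t => ρ⁻¹ • (Y n t - c)) (z := fun t => ρ⁻¹ • (u t - c)) (M := M) (Z := Z)
        hM hZ0 (fun n => (hxm n).aestronglyMeasurable)
        (fun n => (((hstep (φ (k n)) fun i => U (φ (k n)) (i + 1)).sub
          stronglyMeasurable_const).const_smul ρ⁻¹).aestronglyMeasurable) hym hzm
        (fun n => ae_of_all _ (hxM n)) hyM (fun n => hIm (hYb n)) (hIm hzb)
        (ae_of_all _ hzlim) ?_ ?_
      · filter_upwards [this] with t ht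
        have e : u t - c + ρ • y t = ρ • (ρ⁻¹ • (u t - c) + y t) := by
          rw [smul_add, smul_inv_smul₀ hρ0.ne']
        rw [e, norm_smul, norm_smul]
        exact mul_le_mul_of_nonneg_left ht (norm_nonneg _)
      · intro A hA σ hσ
        have e : ∀ v : ℝ → B,
            ∫ t, (dualMapJ p (σ • ρ⁻¹ • (u t - c) + v t) - dualMapJ p (v t)) (v t)
              * A.indicator (fun _ => (1 : ℝ)) t ∂μ
            = ∫ t in A, (dualMapJ p (σ • ρ⁻¹ • (u t - c) + v t) - dualMapJ p (v t)) (v t) ∂μ := by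
          intro v
          rw [← integral_indicator hA]
          congr 1 with t
          by_cases ht : t ∈ A <;> simp [ht]
        have := hJ (fun t => σ • ρ⁻¹ • (u t - c)) (hzm.const_smul σ)
          ⟨|σ| * Z, hIm fun t ht => by
            rw [norm_smul, Real.norm_eq_abs]
            exact mul_le_mul_of_nonneg_left (hzb t ht) (abs_nonneg _)⟩
          (A.indicator fun _ => 1) ((integrable_const 1).indicator hA)
        rw [e] at this
        exact this.congr fun n => e _
      · refine fun n => ae_of_all _ fun t => ?_
        have := (mem_gammaSet_iff.1 (hDg (φ (k n)) ⌊t / h (φ (k n))⌋₊)).2 c hc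
        have e : Y n t - c + ρ • x n t = ρ • (ρ⁻¹ • (Y n t - c) + x n t) := by
          rw [smul_add, smul_inv_smul₀ hρ0.ne']
        change ‖ρ • x n t‖ ≤ ‖Y n t - c + ρ • x n t‖ at this
        rw [e, norm_smul, norm_smul] at this
        exact le_of_mul_le_mul_left this (norm_pos_iff.2 hρ0.ne')
    have hall : ∀ᵐ t ∂μ, ∀ j : ℕ, ‖ρ • y t‖
        ≤ ‖u t - (TopologicalSpace.denseSeq C j : B) + ρ • y t‖ :=
      ae_all_iff.2 fun j => hpt _ (Subtype.coe_prop _)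
    filter_upwards [hall] with t ht
    rw [sub_sub_cancel]
    refine ⟨ρ, hρ0, mem_gammaSet_iff.2 ⟨huC t, fun c hc => ?_⟩⟩
    have hcl : IsClosed {c : C | ‖ρ • y t‖ ≤ ‖u t - (c : B) + ρ • y t‖} :=
      isClosed_le continuous_const (by fun_prop)
    exact (TopologicalSpace.denseRange_denseSeq C).induction_on (p := fun c : C =>
      ‖ρ • y t‖ ≤ ‖u t - (c : B) + ρ • y t‖) ⟨c, hc⟩ hcl ht
  · filter_upwards [hyM] with t ht
    rw [sub_sub_cancel_left, norm_neg]
    exact ht
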